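/- There is an absolute constant C such that for every complete graph G=K_n on n ≥ 2 vertices, the deterministic edge cover time satisfies ẼC(G) ≤ C·κ̃·n². -/

import Mathlib

/-- A rotor configuration on `G`: each vertex `u` carries a rotor sequence of length `d u`
(encoded as a `(d u)`-periodic map `s u : ℕ → V`) consisting of neighbors of `u`, in which
every neighbor of `u` occurs exactly `d u / deg u` times, together with an initial rotor
position `r0 u`. -/
structure RotorConfig {V : Type*} [Fintype V] [DecidableEq V]
    (G : SimpleGraph V) [DecidableRel G.Adj] where
  d : V → ℕ
  d_pos : ∀ u, 0 < d u
  s : V → ℕ → V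
  periodic : ∀ u i, s u (i + d u) = s u i
  adj : ∀ u i, i < d u → G.Adj u (s u i)
  count : ∀ u v, G.Adj u v →
    ((Finset.range (d u)).filter (fun i => s u i = v)).card = d u / G.degree u
  r0 : V → ℕ

namespace RotorConfig

variable {V : Type*} [Fintype V] [DecidableEq V] {G : SimpleGraph V} [DecidableRel G.Adj]

/-- `κ̃ = max_u d̃(u)/deg(u)`. -/
def kappa (cfg : RotorConfig G) : ℕ :=
  Finset.univ.sup fun u => cfg.d u / G.degree u

/-- One step of the rotor walk; a state is a pair (current vertex, rotor positions). -/
def step (cfg : RotorConfig G) (st : V × (V → ℕ)) : V × (V → ℕ) :=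
  (cfg.s st.1 (st.2 st.1), Function.update st.2 st.1 (st.2 st.1 + 1))

/-- The state of the rotor walk started at `x0` after `t` steps. -/
def state (cfg : RotorConfig G) (x0 : V) : ℕ → V × (V → ℕ)
  | 0 => (x0, cfg.r0)
  | t + 1 => cfg.step (state cfg x0 t)

/-- The position of the rotor walk started at `x0` after `t` steps. -/
def pos (cfg : RotorConfig G) (x0 : V) (t : ℕ) : V := (cfg.state x0 t).1

/-- Every edge of `G` is traversed (in some direction) within the first `t` steps of the
rotor walk started at `x0`. -/
def coversEdges (cfg : RotorConfig G) (x0 : V) (t : ℕ) : Prop :=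
  ∀ u v : V, G.Adj u v → ∃ ℓ, 1 ≤ ℓ ∧ ℓ ≤ t ∧
    ((cfg.pos x0 (ℓ - 1) = u ∧ cfg.pos x0 ℓ = v) ∨
     (cfg.pos x0 (ℓ - 1) = v ∧ cfg.pos x0 ℓ = u))

end RotorConfig

namespace RotorConfig

variable {V : Type*} [Fintype V] [DecidableEq V] {G : SimpleGraph V} [DecidableRel G.Adj]

/-- number of departures from `u` before time `t` -/
def visits (cfg : RotorConfig G) (x0 : V) (u : V) (t : ℕ) : ℕ :=
  Nat.count (fun i => cfg.pos x0 i = u) t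

/-- number of traversals of the arc `w → u` before time `t` -/
def arcs (cfg : RotorConfig G) (x0 : V) (w u : V) (t : ℕ) : ℕ :=
  Nat.count (fun i => cfg.pos x0 i = w ∧ cfg.pos x0 (i + 1) = u) t

theorem rotor_eq (cfg : RotorConfig G) (x0 u : V) (t : ℕ) :
    (cfg.state x0 t).2 u = cfg.r0 u + cfg.visits x0 u t := by
  induction t with
  | zero => simp [state, visits]
  | succ t ih =>
    unfold visits at *
    rw [Nat.count_succ]
    simp only [state, step, pos]
    by_cases h : (cfg.state x0 t).1 = u
    · subst h
      simp only [Function.update_self, if_true]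
      rw [ih]; rfl
    · rw [Function.update_of_ne (Ne.symm h), ih]
      simp [h, pos]

theorem arcs_eq (cfg : RotorConfig G) (x0 w u : V) (t : ℕ) :
    cfg.arcs x0 w u t =
      Nat.count (fun j => cfg.s w (cfg.r0 w + j) = u) (cfg.visits x0 w t) := by
  induction t with
  | zero => simp [arcs, visits]
  | succ t ih =>
    unfold arcs at *
    have hv : cfg.visits x0 w (t + 1) =
        cfg.visits x0 w t + if cfg.pos x0 t = w then 1 else 0 := by
      unfold visits; rw [Nat.count_succ]
    rw [Nat.count_succ, ih, hv]
    by_cases h : cfg.pos x0 t = w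
    · have h2 : cfg.pos x0 (t + 1) = cfg.s w (cfg.r0 w + cfg.visits x0 w t) := by
        rw [← rotor_eq, ← h]; rfl
      simp only [h, if_true, true_and, Nat.count_succ, h2]
    · simp [h]

theorem count_mul (cfg : RotorConfig G) (w u : V) (h : G.Adj w u) (q : ℕ) :
    Nat.count (fun j => cfg.s w (cfg.r0 w + j) = u) (q * cfg.d w) =
      q * (cfg.d w / G.degree w) := by
  have key : ∀ a, Nat.count (fun j => cfg.s w (a + j) = u) (cfg.d w) =
      cfg.d w / G.degree w := by
    intro a
    have hp : Function.Periodic (fun j => cfg.s w j = u) (cfg.d w) := by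
      intro i; simp [cfg.periodic]
    have h1 := Nat.filter_Ico_card_eq_of_periodic a (cfg.d w) _ hp
    have h2 := cfg.count w u h
    rw [← Nat.count_eq_card_filter_range] at h2
    rw [h2] at h1
    have h3 := Nat.count_add (fun j => cfg.s w j = u) a (cfg.d w)
    rw [← h1, Nat.count_eq_card_filter_range]
    refine Finset.card_bij (fun x _ => a + x) ?_ ?_ ?_
    · intro x hx; simp at hx ⊢; exact hx
    · intro x _ y _ hxy; omega
    · intro b hb
      simp at hb
      refine ⟨b - a, ?_, by omega⟩
      simp
      refine ⟨by omega, ?_⟩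
      rw [Nat.add_sub_cancel' hb.1.1]; exact hb.2
  induction q with
  | zero => simp
  | succ q ih =>
    rw [Nat.succ_mul, Nat.count_add, ih, Nat.succ_mul]
    congr 1
    rw [← key (cfg.r0 w + q * cfg.d w)]
    simp only [add_assoc]

theorem d_eq (cfg : RotorConfig G) (w : V) :
    cfg.d w = G.degree w * (cfg.d w / G.degree w) := by
  have h := Finset.card_eq_sum_card_fiberwise (s := Finset.range (cfg.d w))
    (t := G.neighborFinset w) (f := cfg.s w) (by
      intro i hi
      simp at hi ⊢
      exact cfg.adj w i hi)
  rw [Finset.card_range, Finset.sum_congr rfl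
    (fun v hv => cfg.count w v (by simpa using hv))] at h
  simpa using h

theorem sum_visits (cfg : RotorConfig G) (x0 : V) (t : ℕ) :
    ∑ w, cfg.visits x0 w t = t := by
  unfold visits
  induction t with
  | zero => simp
  | succ t ih => simp [Nat.count_succ, Finset.sum_add_distrib, ih]

theorem sum_arcs (cfg : RotorConfig G) (x0 u : V) (t : ℕ) :
    ∑ w, cfg.arcs x0 w u t = Nat.count (fun i => cfg.pos x0 (i + 1) = u) t := by
  unfold arcs
  induction t with
  | zero => simp
  | succ t ih => simp [Nat.count_succ, Finset.sum_add_distrib, ih, ite_and]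

theorem sum_arcs_le (cfg : RotorConfig G) (x0 u : V) (t : ℕ) :
    ∑ w, cfg.arcs x0 w u t ≤ cfg.visits x0 u t + 1 := by
  rw [sum_arcs]
  have h := Nat.count_succ' (fun i => cfg.pos x0 i = u) t
  have h2 := Nat.count_succ (fun i => cfg.pos x0 i = u) t
  unfold visits
  split_ifs at h h2 <;> omega

theorem visits_le (cfg : RotorConfig G) (x0 w u : V) (h : G.Adj w u) (t : ℕ) :
    cfg.visits x0 w t ≤
      G.degree w * cfg.arcs x0 w u t + G.degree w * (cfg.d w / G.degree w) := by
  rw [arcs_eq]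
  set N := cfg.visits x0 w t
  have h1 := Nat.count_monotone (fun j => cfg.s w (cfg.r0 w + j) = u)
    (Nat.div_mul_le_self N (cfg.d w))
  rw [cfg.count_mul w u h] at h1
  have h2 := Nat.lt_div_mul_add (a := N) (cfg.d_pos w)
  have h3 := cfg.d_eq w
  have h4 := Nat.mul_le_mul_left (G.degree w) h1
  have h5 : G.degree w * (N / cfg.d w * (cfg.d w / G.degree w)) = N / cfg.d w * cfg.d w := by
    rw [mul_left_comm, ← h3]
  rw [h5] at h4
  omega

theorem arcs_pos (cfg : RotorConfig G) (x0 w u : V) (h : G.Adj w u) (t : ℕ)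
    (ht : cfg.d w ≤ cfg.visits x0 w t) : 0 < cfg.arcs x0 w u t := by
  rw [arcs_eq]
  have h1 := Nat.count_monotone (fun j => cfg.s w (cfg.r0 w + j) = u) ht
  have h2 := cfg.count_mul w u h 1
  rw [one_mul, one_mul] at h2
  rw [h2] at h1
  refine lt_of_lt_of_le ?_ h1
  have h3 := cfg.d_eq w
  have h4 := cfg.d_pos w
  rw [h3] at h4
  exact Nat.pos_of_mul_pos_left h4

theorem covers_of_visits (cfg : RotorConfig G) (x0 : V) (t : ℕ)
    (ht : ∀ w, cfg.d w ≤ cfg.visits x0 w t) : cfg.coversEdges x0 t := by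
  intro u v h
  have h1 := cfg.arcs_pos x0 u v h t (ht u)
  unfold arcs at h1
  rw [Nat.count_eq_card_filter_range, Finset.card_pos] at h1
  obtain ⟨i, hi⟩ := h1
  simp at hi
  exact ⟨i + 1, by omega, by omega, Or.inl (by simpa using hi.2)⟩

end RotorConfig

/-- There is an absolute constant `C` such that for every complete graph
on `n ≥ 2` vertices, the deterministic edge cover time satisfies `ẼC(K_n) ≤ C·κ̃·n²`. -/
theorem detEdgeCover_complete_le :
    ∃ C : ℝ, 0 < C ∧
      ∀ n : ℕ, 2 ≤ n →
        ∀ (cfg : RotorConfig (⊤ : SimpleGraph (Fin n))) (x0 : Fin n),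
          ∃ t : ℕ, (t : ℝ) ≤ C * (cfg.kappa : ℝ) * (n : ℝ) ^ 2 ∧ cfg.coversEdges x0 t := by
  refine ⟨4, by norm_num, ?_⟩
  intro n hn cfg x0
  refine ⟨4 * cfg.kappa * n ^ 2, by push_cast; exact le_rfl, ?_⟩
  apply cfg.covers_of_visits
  intro u
  by_contra! hlt
  set t := 4 * cfg.kappa * n ^ 2 with ht
  obtain ⟨m, rfl⟩ : ∃ m, n = m + 1 := ⟨n - 1, by omega⟩
  have hdeg : ∀ w, (⊤ : SimpleGraph (Fin (m + 1))).degree w = m := by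
    intro w; simp
  have hk : ∀ w, cfg.d w / m ≤ cfg.kappa := by
    intro w
    have := Finset.le_sup (f := fun u => cfg.d u / (⊤ : SimpleGraph (Fin (m + 1))).degree u)
      (Finset.mem_univ w)
    simp only [hdeg] at this
    refine this.trans_eq ?_
    unfold RotorConfig.kappa
    simp only [hdeg]
  have hd : ∀ w, cfg.d w ≤ m * cfg.kappa := by
    intro w
    have h := cfg.d_eq w
    rw [hdeg] at h
    rw [h]
    exact Nat.mul_le_mul_left m (hk w)
  have hkpos : 1 ≤ cfg.kappa := by
    have h1 := hd u
    have h2 := cfg.d_pos u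
    by_contra hc
    have : cfg.kappa = 0 := by omega
    rw [this] at h1
    omega
  have hb : ∀ w, cfg.visits x0 w t ≤ m * cfg.arcs x0 w u t + m * cfg.kappa := by
    intro w
    by_cases h : w = u
    · subst h
      have := hd w
      omega
    · have h1 := cfg.visits_le x0 w u (by simpa using h) t
      rw [hdeg] at h1
      have h2 := Nat.mul_le_mul_left m (hk w)
      omega
  have hs := Finset.sum_le_sum (fun w (_ : w ∈ Finset.univ) => hb w)
  rw [cfg.sum_visits, Finset.sum_add_distrib, ← Finset.mul_sum] at hs
  have ha := cfg.sum_arcs_le x0 u t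
  have hdu := hd u
  have ha2 : ∑ w, cfg.arcs x0 w u t ≤ m * cfg.kappa := by omega
  have ha3 := Nat.mul_le_mul_left m ha2
  simp only [Finset.sum_const, Finset.card_univ, Fintype.card_fin, smul_eq_mul] at hs
  have : t ≤ m * (m * cfg.kappa) + (m + 1) * (m * cfg.kappa) := by omega
  rw [ht] at this
  nlinarith [Nat.zero_le (m * m * cfg.kappa), Nat.zero_le (m * cfg.kappa)]
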